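/- Let X, Y be measurable spaces, l : Y × Y → [0,1] a measurable loss function, 𝓟 the set of all probability distributions on X × Y, Q a probability distribution on 𝓟, and H a hypothesis space for which all quantities below are measurable. Let the (n,m)-sample z be generated by sampling P_1,…,P_n independently from Q and then sampling m points independently from each P_i. Then the empirical loss êr_z(H) is a downward-biased estimate of er_Q(H): the expectation over the random (n,m)-sample z of êr_z(H) = (1/n) Σ_{i=1}^n inf_{h∈H} (1/m) Σ_{j=1}^m l(h(x_{ij}),y_{ij}) is at most er_Q(H). -/

import Mathlib

open MeasureTheory
open scoped ENNReal

/-- Probability measures on a measurable space inherit the σ-algebra of the space of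
measures (generated by the evaluation maps). -/
noncomputable instance {Ω : Type*} [MeasurableSpace Ω] :
    MeasurableSpace (ProbabilityMeasure Ω) := by
  unfold ProbabilityMeasure; infer_instance

noncomputable section

namespace BiasLearning

variable {X Y : Type*}

/-- `(h_1,…,h_n)_l`, the average-loss function on `(X × Y)^n` induced by the
`n`-tuple of hypotheses `h` and the loss `l`. -/
def tupleLoss (l : Y → Y → ℝ) (n : ℕ) (h : Fin n → X → Y) :
    (Fin n → X × Y) → ℝ :=
  fun z => (1 / (n : ℝ)) * ∑ i : Fin n, l (h i (z i).1) (z i).2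

/-- `H^n_l`: all functions `(h_1,…,h_n)_l` with every `h_i` taken from the single
hypothesis space `H`. -/
def spaceLoss (l : Y → Y → ℝ) (n : ℕ) (H : Set (X → Y)) :
    Set ((Fin n → X × Y) → ℝ) :=
  {f | ∃ h : Fin n → X → Y, (∀ i, h i ∈ H) ∧ f = tupleLoss l n h}

/-- `𝓗ⁿ_l := ⋃_{H ∈ 𝓗} H^n_l` for a hypothesis space family `𝓗`. -/
def familyLoss (l : Y → Y → ℝ) (n : ℕ) (𝓗 : Set (Set (X → Y))) :
    Set ((Fin n → X × Y) → ℝ) :=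
  ⋃ H ∈ 𝓗, spaceLoss l n H

variable [MeasurableSpace X] [MeasurableSpace Y]

/-- The pseudo-metric `d_𝐏` on functions `(X × Y)^n → ℝ` induced by the product of the
distributions `P_1,…,P_n`. -/
def dP {n : ℕ} (P : Fin n → Measure (X × Y)) (f g : (Fin n → X × Y) → ℝ) : ℝ :=
  ∫ z, |f z - g z| ∂(Measure.pi P)

/-- `𝒩(ε, F, dist)`: the size of the smallest finite `ε`-cover of `F` with respect to the
pseudo-metric `dist` (`⊤` if there is no finite cover). -/
def coverNum {A : Type*} (ε : ℝ) (F : Set A) (dist : A → A → ℝ) : ℕ∞ :=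
  sInf {N : ℕ∞ | ∃ C : Set A, C.Finite ∧ (Nat.card C : ℕ∞) = N ∧
    ∀ f ∈ F, ∃ g ∈ C, dist f g ≤ ε}

/-- `𝒞(ε, 𝓗ⁿ_l) := sup_𝐏 𝒩(ε, 𝓗ⁿ_l, d_𝐏)`, the supremum being over all sequences of `n`
probability distributions on `X × Y`. -/
def capNl (l : Y → Y → ℝ) (n : ℕ) (𝓗 : Set (Set (X → Y))) (ε : ℝ) : ℕ∞ :=
  ⨆ P : Fin n → ProbabilityMeasure (X × Y),
    coverNum ε (familyLoss l n 𝓗) (dP fun i => (P i : Measure (X × Y)))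

/-- The true loss `er_P(h) := ∫ l(h(x),y) dP(x,y)`. -/
def trueErr (l : Y → Y → ℝ) (P : Measure (X × Y)) (h : X → Y) : ℝ :=
  ∫ z, l (h z.1) z.2 ∂P

/-- `H^*(P) := inf_{h ∈ H} er_P(h)`. -/
def Hstar (l : Y → Y → ℝ) (H : Set (X → Y)) : ProbabilityMeasure (X × Y) → ℝ :=
  fun P => ⨅ h : H, trueErr l (P : Measure (X × Y)) h

/-- `𝓗^* := {H^* : H ∈ 𝓗}`. -/
def familyStar (l : Y → Y → ℝ) (𝓗 : Set (Set (X → Y))) :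
    Set (ProbabilityMeasure (X × Y) → ℝ) :=
  (fun H => Hstar l H) '' 𝓗

/-- The pseudo-metric `d_Q` on functions `𝓟 → ℝ` induced by the environmental
distribution `Q`. -/
def dQ (Q : Measure (ProbabilityMeasure (X × Y)))
    (f g : ProbabilityMeasure (X × Y) → ℝ) : ℝ :=
  ∫ P, |f P - g P| ∂Q

/-- `𝒞(ε, 𝓗^*) := sup_Q 𝒩(ε, 𝓗^*, d_Q)`, the supremum being over all probability
distributions `Q` on the space `𝓟` of probability distributions on `X × Y`. -/
def capStar (l : Y → Y → ℝ) (𝓗 : Set (Set (X → Y))) (ε : ℝ) : ℕ∞ :=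
  ⨆ Q : ProbabilityMeasure (ProbabilityMeasure (X × Y)),
    coverNum ε (familyStar l 𝓗) (dQ (Q : Measure (ProbabilityMeasure (X × Y))))

/-- `er_Q(H) := ∫_𝓟 inf_{h ∈ H} er_P(h) dQ(P)`. -/
def envErr (l : Y → Y → ℝ) (Q : Measure (ProbabilityMeasure (X × Y)))
    (H : Set (X → Y)) : ℝ :=
  ∫ P, Hstar l H P ∂Q

/-- `êr_z(H) := (1/n) ∑_i inf_{h ∈ H} (1/m) ∑_j l(h(x_ij), y_ij)`, the empirical loss of
the hypothesis space `H` on the `(n,m)`-sample `z`. -/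
def empErr (l : Y → Y → ℝ) {n m : ℕ} (z : Fin n → Fin m → X × Y)
    (H : Set (X → Y)) : ℝ :=
  (1 / (n : ℝ)) * ∑ i : Fin n,
    ⨅ h : H, (1 / (m : ℝ)) * ∑ j : Fin m, l ((h : X → Y) (z i j).1) (z i j).2

/-- The distribution of an `(n,m)`-sample: draw `P_1,…,P_n` i.i.d. from `Q`, then draw the
`i`-th row as `m` i.i.d. points from `P_i`. -/
def sampleMeasure (Q : Measure (ProbabilityMeasure (X × Y))) (n m : ℕ) :
    Measure (Fin n → Fin m → X × Y) :=
  (Measure.pi fun _ : Fin n => Q).bind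
    (fun Ps => Measure.pi fun i : Fin n =>
      Measure.pi fun _ : Fin m => (Ps i : Measure (X × Y)))

end BiasLearning

open BiasLearning

namespace BiasLearning

variable {X Y : Type*} {l : Y → Y → ℝ} {H : Set (X → Y)}

lemma bddBelow_range_sampleAverage (hl : ∀ y y', 0 ≤ l y y') {m : ℕ} (z : Fin m → X × Y) :
    BddBelow (Set.range fun h : H =>
      (1 / (m : ℝ)) * ∑ j : Fin m, l ((h : X → Y) (z j).1) (z j).2) :=
  ⟨0, by
    rintro _ ⟨h, rfl⟩
    exact mul_nonneg (by positivity) (Finset.sum_nonneg fun j _ => hl _ _)⟩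

lemma empErr_nonneg (hl : ∀ y y', 0 ≤ l y y') {n m : ℕ} (z : Fin n → Fin m → X × Y) :
    0 ≤ empErr l z H :=
  mul_nonneg (by positivity) (Finset.sum_nonneg fun _ _ => Real.iInf_nonneg fun _ =>
    mul_nonneg (by positivity) (Finset.sum_nonneg fun _ _ => hl _ _))

/-- The empirical loss of `H` is at most the average empirical loss of any choice of one
hypothesis in `H` per task. -/
lemma empErr_le_of_mem (hl : ∀ y y', 0 ≤ l y y') {n m : ℕ} (z : Fin n → Fin m → X × Y)
    (h : Fin n → H) :
    empErr l z H ≤ (1 / (n : ℝ)) * ∑ i, (1 / (m : ℝ)) *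
      ∑ j, l ((h i : X → Y) (z i j).1) (z i j).2 := by
  unfold empErr
  gcongr with i
  exact ciInf_le (bddBelow_range_sampleAverage hl (z i)) (h i)

lemma empErr_le_one (hl : ∀ y y', l y y' ∈ Set.Icc (0 : ℝ) 1) (hH : H.Nonempty) {n m : ℕ}
    (z : Fin n → Fin m → X × Y) : empErr l z H ≤ 1 := by
  obtain ⟨h, hh⟩ := hH
  have avg_le_one {k : ℕ} {f : Fin k → ℝ} (hf : ∀ i, f i ≤ 1) :
      (1 / (k : ℝ)) * ∑ i, f i ≤ 1 := by
    calc (1 / (k : ℝ)) * ∑ i, f i ≤ (1 / (k : ℝ)) * ∑ _i : Fin k, 1 := by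
          gcongr with i
          exact hf i
      _ ≤ 1 := by simpa using inv_mul_le_one
  exact (empErr_le_of_mem (fun y y' => (hl y y').1) z fun _ => ⟨h, hh⟩).trans
    (avg_le_one fun i => avg_le_one fun j => (hl _ _).2)

variable [MeasurableSpace X] [MeasurableSpace Y]

lemma trueErr_nonneg (hl : ∀ y y', 0 ≤ l y y') (P : Measure (X × Y)) (h : X → Y) :
    0 ≤ trueErr l P h :=
  integral_nonneg fun _ => hl _ _

lemma Hstar_nonneg (hl : ∀ y y', 0 ≤ l y y') (P : ProbabilityMeasure (X × Y)) :
    0 ≤ Hstar l H P :=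
  Real.iInf_nonneg fun _ => trueErr_nonneg hl _ _

lemma integrable_loss (hl : ∀ y y', l y y' ∈ Set.Icc (0 : ℝ) 1)
    (hlmeas : Measurable (Function.uncurry l)) {h : X → Y} (hh : Measurable h)
    (P : Measure (X × Y)) [IsFiniteMeasure P] :
    Integrable (fun z : X × Y => l (h z.1) z.2) P := by
  have hmeas : Measurable fun z : X × Y => l (h z.1) z.2 :=
    hlmeas.comp ((hh.comp measurable_fst).prodMk measurable_snd)
  exact .of_bound hmeas.aestronglyMeasurable 1 (.of_forall fun z => by
    simpa [abs_of_nonneg (hl _ _).1] using (hl _ _).2)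

lemma Hstar_le_one (hl : ∀ y y', l y y' ∈ Set.Icc (0 : ℝ) 1)
    (hlmeas : Measurable (Function.uncurry l)) (hHmeas : ∀ h ∈ H, Measurable h)
    (hH : H.Nonempty) (P : ProbabilityMeasure (X × Y)) : Hstar l H P ≤ 1 := by
  obtain ⟨h, hh⟩ := hH
  calc Hstar l H P ≤ trueErr l (P : Measure (X × Y)) h :=
        ciInf_le ⟨0, by
          rintro _ ⟨g, rfl⟩
          exact trueErr_nonneg (fun y y' => (hl y y').1) _ _⟩ (⟨h, hh⟩ : H)
    _ ≤ ∫ _, (1 : ℝ) ∂(P : Measure (X × Y)) :=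
        integral_mono (integrable_loss hl hlmeas (hHmeas h hh) _) (integrable_const _)
          fun _ => (hl _ _).2
    _ = 1 := by simp

/-- For fixed tasks `P_1,…,P_n`, the expected empirical loss of `H` is at most the average of
the optimal true losses. -/
lemma integral_empErr_le_average_Hstar (hl : ∀ y y', l y y' ∈ Set.Icc (0 : ℝ) 1)
    (hlmeas : Measurable (Function.uncurry l)) (hHmeas : ∀ h ∈ H, Measurable h)
    (hH : H.Nonempty) {n m : ℕ} (hn : n ≠ 0) (hm : m ≠ 0)
    (P : Fin n → ProbabilityMeasure (X × Y)) :
    ∫ z, empErr l z H ∂(Measure.pi fun i : Fin n =>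
        Measure.pi fun _ : Fin m => (P i : Measure (X × Y)))
      ≤ (1 / (n : ℝ)) * ∑ i, Hstar l H (P i) := by
  have hl0 : ∀ y y', 0 ≤ l y y' := fun y y' => (hl y y').1
  have := hH.to_subtype
  refine le_of_forall_pos_le_add fun ε hε => ?_
  choose h hh using fun i => exists_lt_of_ciInf_lt (lt_add_of_pos_right (Hstar l H (P i)) hε)
  set μ := Measure.pi fun i : Fin n => Measure.pi fun _ : Fin m => (P i : Measure (X × Y))
  have hmp (i : Fin n) (j : Fin m) :
      MeasurePreserving (fun z : Fin n → Fin m → X × Y => z i j) μ (P i) :=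
    (measurePreserving_eval (fun _ : Fin m => (P i : Measure (X × Y))) j).comp
      (measurePreserving_eval
        (fun i : Fin n => Measure.pi fun _ : Fin m => (P i : Measure (X × Y))) i)
  have hloss (i : Fin n) := integrable_loss hl hlmeas (hHmeas _ (h i).2) (P i : Measure (X × Y))
  have hint (i : Fin n) (j : Fin m) :
      Integrable (fun z => l ((h i : X → Y) (z i j).1) (z i j).2) μ :=
    (hmp i j).integrable_comp_of_integrable (hloss i)
  have hval (i : Fin n) (j : Fin m) :
      ∫ z, l ((h i : X → Y) (z i j).1) (z i j).2 ∂μ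
        = trueErr l (P i : Measure (X × Y)) (h i) := by
    rw [trueErr, ← (hmp i j).map_eq, integral_map (hmp i j).aemeasurable]
    rw [(hmp i j).map_eq]
    exact (hloss i).aestronglyMeasurable
  have hrow (i : Fin n) :
      Integrable (fun z => (1 / (m : ℝ)) * ∑ j, l ((h i : X → Y) (z i j).1) (z i j).2) μ :=
    (integrable_finsetSum _ fun j _ => hint i j).const_mul _
  calc ∫ z, empErr l z H ∂μ
      ≤ ∫ z, (1 / (n : ℝ)) * ∑ i, (1 / (m : ℝ)) *
          ∑ j, l ((h i : X → Y) (z i j).1) (z i j).2 ∂μ :=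
        integral_mono_of_nonneg (.of_forall fun z => empErr_nonneg hl0 z)
          ((integrable_finsetSum _ fun i _ => hrow i).const_mul _)
          (.of_forall fun z => empErr_le_of_mem hl0 z h)
    _ = (1 / (n : ℝ)) * ∑ i, trueErr l (P i : Measure (X × Y)) (h i) := by
        rw [integral_const_mul, integral_finsetSum _ fun i _ => hrow i]
        congr 1
        refine Finset.sum_congr rfl fun i _ => ?_
        rw [integral_const_mul, integral_finsetSum _ fun j _ => hint i j]
        simp [hval, hm]
    _ ≤ (1 / (n : ℝ)) * ∑ i, (Hstar l H (P i) + ε) := by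
        gcongr with i
        exact (hh i).le
    _ = (1 / (n : ℝ)) * ∑ i, Hstar l H (P i) + ε := by
        rw [Finset.sum_add_distrib, mul_add]
        simp [hn]

end BiasLearning

/-- The Bochner integral against `μ.bind κ` is the iterated integral. -/
lemma MeasureTheory.Measure.integral_bind_of_measurable {α β : Type*} [MeasurableSpace α]
    [MeasurableSpace β] {μ : Measure α} [IsFiniteMeasure μ] {κ : α → Measure β}
    (hκ : Measurable κ) [∀ a, IsProbabilityMeasure (κ a)] {f : β → ℝ}
    (hf : Integrable f (μ.bind κ)) :
    ∫ y, f y ∂(μ.bind κ) = ∫ x, ∫ y, f y ∂(κ x) ∂μ := by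
  let η : ProbabilityTheory.Kernel α β := ⟨κ, hκ⟩
  have : ProbabilityTheory.IsMarkovKernel η :=
    ⟨fun a => inferInstanceAs (IsProbabilityMeasure (κ a))⟩
  have hcomp : (ProbabilityTheory.Kernel.comp η (.const Unit μ)) () = μ.bind κ := by
    rw [ProbabilityTheory.Kernel.comp_apply]
    rfl
  rw [← hcomp] at hf ⊢
  exact ProbabilityTheory.Kernel.integral_comp hf

/-- **The empirical loss is a downward-biased estimate of `er_Q(H)`** (remark after
equation (13) of the paper).  For a `[0,1]`-valued measurable loss `l` and a hypothesis
space `H` (with the required measurability), the expectation, over an `(n,m)`-sample `z`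
generated by drawing `P_1,…,P_n` i.i.d. from `Q` and then `m` i.i.d. points from each
`P_i`, of `êr_z(H) = (1/n) ∑_i inf_{h∈H} (1/m) ∑_j l(h(x_ij),y_ij)` is at most
`er_Q(H) = ∫ inf_{h∈H} er_P(h) dQ(P)`. -/
theorem empirical_loss_downward_biased
    {X Y : Type*} [MeasurableSpace X] [MeasurableSpace Y]
    (l : Y → Y → ℝ) (hlrange : ∀ y y', l y y' ∈ Set.Icc (0 : ℝ) 1)
    (hlmeas : Measurable (Function.uncurry l))
    (H : Set (X → Y)) (hHmeas : ∀ h ∈ H, Measurable h)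
    (Q : Measure (ProbabilityMeasure (X × Y))) [IsProbabilityMeasure Q]
    (n m : ℕ) (hn : 1 ≤ n) (hm : 1 ≤ m)
    (hkernel : Measurable fun Ps : Fin n → ProbabilityMeasure (X × Y) =>
      Measure.pi fun i : Fin n =>
        Measure.pi fun _ : Fin m => (Ps i : Measure (X × Y)))
    (hstarmeas : Measurable (Hstar l H))
    (hempmeas : Measurable fun z : Fin n → Fin m → X × Y => empErr l z H) :
    ∫ z, empErr l z H ∂(sampleMeasure Q n m) ≤ envErr l Q H := by
  rcases H.eq_empty_or_nonempty with rfl | hH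
  · simp [empErr, envErr, Hstar]
  have hl0 : ∀ y y', 0 ≤ l y y' := fun y y' => (hlrange y y').1
  have hn0 : n ≠ 0 := by omega
  have hm0 : m ≠ 0 := by omega
  have : IsProbabilityMeasure (sampleMeasure Q n m) :=
    isProbabilityMeasure_bind hkernel.aemeasurable (.of_forall fun _ => inferInstance)
  have hemp : Integrable (fun z => empErr l z H) (sampleMeasure Q n m) :=
    .of_bound hempmeas.aestronglyMeasurable 1 (.of_forall fun z => by
      simpa [abs_of_nonneg (empErr_nonneg hl0 z)] using empErr_le_one hlrange hH z)
  have hstar : Integrable (Hstar l H) Q :=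
    .of_bound hstarmeas.aestronglyMeasurable 1 (.of_forall fun P => by
      simpa [abs_of_nonneg (Hstar_nonneg hl0 P)] using
        Hstar_le_one hlrange hlmeas hHmeas hH P)
  have hmp (i : Fin n) := measurePreserving_eval (fun _ : Fin n => Q) i
  have hstar_eval (i : Fin n) :
      Integrable (fun P : Fin n → ProbabilityMeasure (X × Y) => Hstar l H (P i))
        (Measure.pi fun _ => Q) :=
    (hmp i).integrable_comp_of_integrable hstar
  calc ∫ z, empErr l z H ∂(sampleMeasure Q n m)
      = ∫ P : Fin n → ProbabilityMeasure (X × Y), ∫ z, empErr l z H ∂(Measure.pi fun i =>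
          Measure.pi fun _ : Fin m => (P i : Measure (X × Y))) ∂(Measure.pi fun _ => Q) :=
        Measure.integral_bind_of_measurable hkernel hemp
    _ ≤ ∫ P : Fin n → ProbabilityMeasure (X × Y), (1 / (n : ℝ)) * ∑ i, Hstar l H (P i)
          ∂(Measure.pi fun _ => Q) :=
        integral_mono_of_nonneg
          (.of_forall fun _ => integral_nonneg fun z => empErr_nonneg hl0 z)
          ((integrable_finsetSum _ fun i _ => hstar_eval i).const_mul _)
          (.of_forall fun P =>
            integral_empErr_le_average_Hstar hlrange hlmeas hHmeas hH hn0 hm0 P)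
    _ = envErr l Q H := by
        rw [integral_const_mul, integral_finsetSum _ fun i _ => hstar_eval i]
        have hval (i : Fin n) :
            ∫ P : Fin n → ProbabilityMeasure (X × Y), Hstar l H (P i) ∂(Measure.pi fun _ => Q)
              = envErr l Q H :=
          integral_comp_eval hstar.aestronglyMeasurable
        simp [hval, hn0]
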